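/- Vey's isochore Morse lemma: let f ∈ 𝒪₂ satisfy f(0) = 0, ∇f(0) = 0, and det Hess f(0) ≠ 0 (nondegenerate quadratic part). Then there exist a symplectomorphism germ φ : (ℂ²,0) → (ℂ²,0) (a local biholomorphism with φ(0) = 0 and det Dφ ≡ 1, i.e. φ*(dx∧dy) = dx∧dy) and a biholomorphism germ ψ : (ℂ,0) → (ℂ,0) such that f(φ(x,y)) = ψ(xy) for all (x,y) near 0. -/

import Mathlib

open Filter Topology

/-- The determinant of the Jacobian matrix (in the coordinates `(x,y)` of `ℂ²`)
of a map `φ : ℂ² → ℂ²` at the point `z`. -/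
noncomputable def jacDet2 (φ : ℂ × ℂ → ℂ × ℂ) (z : ℂ × ℂ) : ℂ :=
  (fderiv ℂ φ z (1, 0)).1 * (fderiv ℂ φ z (0, 1)).2 -
    (fderiv ℂ φ z (0, 1)).1 * (fderiv ℂ φ z (1, 0)).2

/-- The determinant of the Hessian of `f : ℂ² → ℂ` at `0`. -/
noncomputable def hessDet2 (f : ℂ × ℂ → ℂ) : ℂ :=
  (fderiv ℂ (fun z => fderiv ℂ f z (1, 0)) 0 (1, 0)) *
      (fderiv ℂ (fun z => fderiv ℂ f z (0, 1)) 0 (0, 1)) -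
    (fderiv ℂ (fun z => fderiv ℂ f z (1, 0)) 0 (0, 1)) *
      (fderiv ℂ (fun z => fderiv ℂ f z (0, 1)) 0 (1, 0))

lemma ContinuousLinearMap.comp_analyticAt {E F G : Type*} [NormedAddCommGroup E] [NormedSpace ℂ E]
    [NormedAddCommGroup F] [NormedSpace ℂ F] [NormedAddCommGroup G] [NormedSpace ℂ G]
    (L : F →L[ℂ] G) {f : E → F} {x : E} (hf : AnalyticAt ℂ f x) :
    AnalyticAt ℂ (fun z => L (f z)) x :=
  (L.analyticAt (f x)).fun_comp hf

/-- The sum of the double power series with coefficients `c`. -/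
noncomputable def doubleSeries (c : ℕ × ℕ → ℂ) (z : ℂ × ℂ) : ℂ :=
  ∑' m : ℕ × ℕ, c m * (z.1 ^ m.1 * z.2 ^ m.2)

/-- Geometric growth of the coefficients of a double power series. -/
def GeomBound (c : ℕ × ℕ → ℂ) (C ρ : ℝ) : Prop :=
  0 < C ∧ 0 < ρ ∧ ∀ m : ℕ × ℕ, ‖c m‖ ≤ C * ρ ^ (m.1 + m.2)

lemma summable_half_pow_add (C : ℝ) :
    Summable fun m : ℕ × ℕ => C * (1 / 2 : ℝ) ^ (m.1 + m.2) := by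
  have h := summable_geometric_two
  have := h.mul_of_nonneg h (fun _ => by positivity) (fun _ => by positivity)
  simpa only [pow_add] using this.mul_left C

lemma GeomBound.term_le {c : ℕ × ℕ → ℂ} {C ρ : ℝ} (h : GeomBound c C ρ) {z : ℂ × ℂ}
    (hz : ‖z‖ * ρ ≤ 1 / 2) (m : ℕ × ℕ) :
    ‖c m * (z.1 ^ m.1 * z.2 ^ m.2)‖ ≤ C * (1 / 2 : ℝ) ^ (m.1 + m.2) := by
  obtain ⟨hC, hρ, hc⟩ := h
  have h1 : ‖z.1‖ ^ m.1 ≤ ‖z‖ ^ m.1 := by gcongr; exact norm_fst_le z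
  have h2 : ‖z.2‖ ^ m.2 ≤ ‖z‖ ^ m.2 := by gcongr; exact norm_snd_le z
  calc ‖c m * (z.1 ^ m.1 * z.2 ^ m.2)‖ = ‖c m‖ * (‖z.1‖ ^ m.1 * ‖z.2‖ ^ m.2) := by
        simp
    _ ≤ (C * ρ ^ (m.1 + m.2)) * (‖z‖ ^ m.1 * ‖z‖ ^ m.2) := by
        gcongr
        exact hc m
    _ = C * (‖z‖ * ρ) ^ (m.1 + m.2) := by rw [mul_pow, pow_add, pow_add]; ring
    _ ≤ _ := by gcongr

lemma GeomBound.summable {c : ℕ × ℕ → ℂ} {C ρ : ℝ} (h : GeomBound c C ρ) {z : ℂ × ℂ}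
    (hz : ‖z‖ * ρ ≤ 1 / 2) : Summable fun m : ℕ × ℕ => c m * (z.1 ^ m.1 * z.2 ^ m.2) :=
  Summable.of_norm_bounded (summable_half_pow_add C) (h.term_le hz)

lemma GeomBound.hasSum_antidiagonal {c : ℕ × ℕ → ℂ} {C ρ : ℝ} (h : GeomBound c C ρ) {z : ℂ × ℂ}
    (hz : ‖z‖ * ρ ≤ 1 / 2) :
    HasSum (fun n => ∑ m ∈ Finset.HasAntidiagonal.antidiagonal n, c m * (z.1 ^ m.1 * z.2 ^ m.2))
      (doubleSeries c z) := by
  have h2 := ((Finset.HasAntidiagonal.sigmaAntidiagonalEquivProd).hasSum_iff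
      (f := fun m : ℕ × ℕ => c m * (z.1 ^ m.1 * z.2 ^ m.2))).2 (h.summable hz).hasSum
  convert! h2.sigma (fun n => hasSum_fintype _) using 1
  funext n
  exact (Finset.sum_coe_sort (Finset.HasAntidiagonal.antidiagonal n) _).symm

lemma eventually_norm_mul_le (ρ : ℝ) {ε : ℝ} (hε : 0 < ε) :
    ∀ᶠ z in 𝓝 (0 : ℂ × ℂ), ‖z‖ * ρ ≤ ε := by
  have : Tendsto (fun z : ℂ × ℂ => ‖z‖ * ρ) (𝓝 0) (𝓝 0) := by
    have h : Continuous fun z : ℂ × ℂ => ‖z‖ * ρ := by fun_prop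
    simpa using h.tendsto 0
  exact this.eventually_le_const hε

/-- The monomial `x ^ i * y ^ (n - i)` as a multilinear map. -/
noncomputable def monomialMultilinear (n i : ℕ) :
    ContinuousMultilinearMap ℂ (fun _ : Fin n => ℂ × ℂ) ℂ :=
  (ContinuousMultilinearMap.mkPiAlgebraFin ℂ n ℂ).compContinuousLinearMap
    fun k => if (k : ℕ) < i then ContinuousLinearMap.fst ℂ ℂ ℂ else ContinuousLinearMap.snd ℂ ℂ ℂ

lemma norm_monomialMultilinear_le (n i : ℕ) : ‖monomialMultilinear n i‖ ≤ 1 := by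
  refine (ContinuousMultilinearMap.norm_compContinuousLinearMap_le _ _).trans ?_
  rw [ContinuousMultilinearMap.norm_mkPiAlgebraFin, one_mul]
  refine Finset.prod_le_one (fun _ _ => norm_nonneg _) fun k _ => ?_
  split_ifs
  · exact ContinuousLinearMap.norm_fst_le ..
  · exact ContinuousLinearMap.norm_snd_le ..

lemma monomialMultilinear_apply (i j : ℕ) (z : ℂ × ℂ) :
    monomialMultilinear (i + j) i (fun _ => z) = z.1 ^ i * z.2 ^ j := by
  simp only [monomialMultilinear, ContinuousMultilinearMap.compContinuousLinearMap_apply,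
    ContinuousMultilinearMap.mkPiAlgebraFin_apply, List.prod_ofFn, Fin.prod_univ_add]
  simp

lemma GeomBound.analyticAt {c : ℕ × ℕ → ℂ} {C ρ : ℝ} (h : GeomBound c C ρ) :
    AnalyticAt ℂ (doubleSeries c) 0 := by
  obtain ⟨hC, hρ, hc⟩ := id h
  let q : FormalMultilinearSeries ℂ (ℂ × ℂ) ℂ := fun n =>
    ∑ m ∈ Finset.HasAntidiagonal.antidiagonal n, c m • monomialMultilinear n m.1
  have hq : ∀ n, ‖q n‖ ≤ (n + 1) * (C * ρ ^ n) := by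
    intro n
    refine (norm_sum_le _ _).trans ?_
    have : ∀ m ∈ Finset.HasAntidiagonal.antidiagonal n, ‖c m • monomialMultilinear n m.1‖ ≤ C * ρ ^ n := by
      intro m hm
      rw [norm_smul]
      have h1 := hc m
      rw [Finset.HasAntidiagonal.mem_antidiagonal.1 hm] at h1
      have h2 := norm_monomialMultilinear_le n m.1
      calc _ ≤ (C * ρ ^ n) * 1 := by gcongr
        _ = _ := mul_one _
    refine (Finset.sum_le_card_nsmul _ _ _ this).trans ?_
    simp
  have hr : 0 < q.radius := by
    obtain ⟨r, hrdef⟩ : ∃ r : NNReal, (r : ℝ) = (2 * ρ)⁻¹ := ⟨.mk (2 * ρ)⁻¹ (by positivity), rfl⟩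
    have hr0 : 0 < r := by
      rw [← NNReal.coe_pos, hrdef]; positivity
    refine lt_of_lt_of_le (ENNReal.coe_pos.2 hr0) (q.le_radius_of_bound C fun n => ?_)
    calc ‖q n‖ * (r : ℝ) ^ n ≤ ((n + 1) * (C * ρ ^ n)) * ((2 * ρ)⁻¹) ^ n := by
          rw [hrdef]
          gcongr
          exact hq n
      _ = C * (((n : ℝ) + 1) / 2 ^ n) := by
          rw [inv_pow, mul_pow]; field_simp
      _ ≤ C * 1 := by
          gcongr
          rw [div_le_one (by positivity)]
          have : n + 1 ≤ 2 ^ n := Nat.lt_two_pow_self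
          exact_mod_cast this
      _ = C := mul_one _
  refine ((q.hasFPowerSeriesOnBall hr).analyticAt).congr ?_
  filter_upwards [eventually_norm_mul_le ρ (by norm_num : (0 : ℝ) < 1 / 2)] with z hz
  refine Eq.trans (tsum_congr fun n => ?_) (h.hasSum_antidiagonal hz).tsum_eq
  refine (sum_apply _ _ _).trans (Finset.sum_congr rfl fun m hm => ?_)
  obtain ⟨i, j⟩ := m
  obtain rfl := Finset.HasAntidiagonal.mem_antidiagonal.1 hm
  exact congrArg (c (i, j) * ·) (monomialMultilinear_apply i j z)

lemma multilinear_apply_eq_sum_antidiagonal {n : ℕ}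
    (p : ContinuousMultilinearMap ℂ (fun _ : Fin n => ℂ × ℂ) ℂ) (z : ℂ × ℂ) :
    p (fun _ => z) = ∑ m ∈ Finset.HasAntidiagonal.antidiagonal n,
      (∑ s ∈ Finset.powersetCard m.1 (Finset.univ : Finset (Fin n)),
        p (s.piecewise (fun _ => (1, 0)) fun _ => (0, 1))) * (z.1 ^ m.1 * z.2 ^ m.2) := by
  have key : ∀ s : Finset (Fin n), p (s.piecewise (fun _ => (z.1, 0)) fun _ => (0, z.2)) =
      p (s.piecewise (fun _ => (1, 0)) fun _ => (0, 1)) * (z.1 ^ s.card * z.2 ^ (n - s.card)) := by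
    intro s
    have h1 : (s.piecewise (fun _ => (z.1, 0)) fun _ => (0, z.2) : Fin n → ℂ × ℂ) =
        fun k => (if k ∈ s then z.1 else z.2) •
          (s.piecewise (fun _ => (1, 0)) fun _ => (0, 1) : Fin n → ℂ × ℂ) k := by
      funext k
      by_cases hk : k ∈ s <;> simp [hk]
    rw [h1, p.map_smul_univ, smul_eq_mul, mul_comm]
    congr 1
    rw [Finset.prod_ite]
    simp [Finset.filter_not, Finset.card_sdiff, Finset.inter_univ]
  have hz : (fun _ : Fin n => z) = (fun _ => (z.1, 0)) + fun _ => (0, z.2) := by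
    funext k; simp
  conv_lhs => rw [hz]
  rw [p.map_add_univ, ← Finset.powerset_univ, Finset.sum_powerset,
    Finset.Nat.sum_antidiagonal_eq_sum_range_succ_mk]
  simp only [Finset.card_univ, Fintype.card_fin]
  refine Finset.sum_congr rfl fun k _ => ?_
  rw [Finset.sum_mul]
  refine Finset.sum_congr rfl fun s hs => ?_
  rw [key, (Finset.mem_powersetCard.1 hs).2]

lemma AnalyticAt.exists_doubleSeries {f : ℂ × ℂ → ℂ} (hf : AnalyticAt ℂ f 0) :
    ∃ c C ρ, GeomBound c C ρ ∧ ∀ᶠ z in 𝓝 (0 : ℂ × ℂ), f z = doubleSeries c z := by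
  obtain ⟨p, r, hp⟩ := hf
  obtain ⟨C, a, hC, ha, hpn⟩ := p.le_mul_pow_of_radius_pos (hp.r_pos.trans_le hp.r_le)
  let A : ℕ → ℕ → ℂ := fun n i => ∑ s ∈ Finset.powersetCard i (Finset.univ : Finset (Fin n)),
    p n (s.piecewise (fun _ => (1, 0)) fun _ => (0, 1))
  have hA : ∀ n i, ‖A n i‖ ≤ C * (2 * a) ^ n := by
    intro n i
    have h1 : ∀ s ∈ Finset.powersetCard i (Finset.univ : Finset (Fin n)),
        ‖p n (s.piecewise (fun _ => (1, 0)) fun _ => (0, 1))‖ ≤ C * a ^ n := by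
      intro s _
      refine ((p n).le_opNorm _).trans ?_
      have : ∏ k : Fin n, ‖(s.piecewise (fun _ => (1, 0)) fun _ => (0, 1) : Fin n → ℂ × ℂ) k‖
          ≤ 1 := by
        refine Finset.prod_le_one (fun _ _ => norm_nonneg _) fun k _ => ?_
        by_cases hk : k ∈ s <;> simp [hk, Prod.norm_def]
      calc _ ≤ (C * a ^ n) * 1 := by gcongr; exact hpn n
        _ = _ := mul_one _
    refine ((norm_sum_le _ _).trans (Finset.sum_le_card_nsmul _ _ _ h1)).trans ?_
    rw [Finset.card_powersetCard, Finset.card_univ, Fintype.card_fin, nsmul_eq_mul, mul_pow]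
    have h2 : ((n.choose i : ℕ) : ℝ) ≤ 2 ^ n := by exact_mod_cast Nat.choose_le_two_pow n i
    calc _ ≤ (2 : ℝ) ^ n * (C * a ^ n) := by gcongr
      _ = _ := by ring
  have hb : GeomBound (fun m => A (m.1 + m.2) m.1) C (2 * a) :=
    ⟨hC, by positivity, fun m => hA _ _⟩
  refine ⟨_, _, _, hb, ?_⟩
  filter_upwards [eventually_norm_mul_le (2 * a) (by norm_num : (0 : ℝ) < 1 / 2),
    Metric.eball_mem_nhds 0 hp.r_pos] with z hz hzr
  have h1 := hp.hasSum hzr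
  rw [zero_add] at h1
  refine h1.unique ?_
  convert! hb.hasSum_antidiagonal hz using 1
  funext n
  rw [multilinear_apply_eq_sum_antidiagonal]
  refine Finset.sum_congr rfl fun m hm => ?_
  obtain rfl := Finset.HasAntidiagonal.mem_antidiagonal.1 hm
  rfl

lemma GeomBound.mono {c c' : ℕ × ℕ → ℂ} {C ρ : ℝ} (h : GeomBound c C ρ)
    (hc : ∀ m, ‖c' m‖ ≤ ‖c m‖) : GeomBound c' C ρ :=
  ⟨h.1, h.2.1, fun m => (hc m).trans (h.2.2 m)⟩

lemma GeomBound.doubleSeries_add {c c' : ℕ × ℕ → ℂ} {C ρ : ℝ} (h : GeomBound c C ρ)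
    (h' : GeomBound c' C ρ) {z : ℂ × ℂ} (hz : ‖z‖ * ρ ≤ 1 / 2) :
    doubleSeries (fun m => c m + c' m) z = doubleSeries c z + doubleSeries c' z := by
  simp only [doubleSeries, add_mul]
  exact (h.summable hz).tsum_add (h'.summable hz)

lemma hasDerivAt_hyperbolicFlow (z : ℂ × ℂ) :
    HasDerivAt (fun s : ℂ => (Complex.exp s * z.1, Complex.exp (-s) * z.2)) (z.1, -z.2) 0 := by
  have h1 := (Complex.hasDerivAt_exp 0).mul_const z.1
  have h2 := ((hasDerivAt_neg (0 : ℂ)).cexp).mul_const z.2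
  convert! h1.prodMk h2 using 1
  simp

lemma norm_exp_le_two {s : ℂ} (hs : ‖s‖ ≤ 1 / 2) : ‖Complex.exp s‖ ≤ 2 := by
  refine (Complex.norm_exp_le_exp_norm s).trans ((Real.exp_le_exp.2 hs).trans ?_)
  have h1 := Real.exp_one_lt_d9
  have h2 : Real.exp (1 / 2) * Real.exp (1 / 2) = Real.exp 1 := by
    rw [← Real.exp_add]; norm_num
  nlinarith [Real.exp_pos (1 / 2)]

lemma GeomBound.fderiv_hyperbolic {c : ℕ × ℕ → ℂ} {C ρ : ℝ} (h : GeomBound c C ρ) :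
    ∀ᶠ z in 𝓝 (0 : ℂ × ℂ), fderiv ℂ (doubleSeries c) z (z.1, -z.2) =
      doubleSeries (fun m => ((m.1 : ℂ) - m.2) * c m) z := by
  filter_upwards [eventually_norm_mul_le ρ (by norm_num : (0 : ℝ) < 1 / 4),
    h.analyticAt.eventually_analyticAt] with z hz han
  have hρ := h.2.1
  let γ : ℂ → ℂ × ℂ := fun s => (Complex.exp s * z.1, Complex.exp (-s) * z.2)
  have hγ : HasDerivAt γ (z.1, -z.2) 0 := hasDerivAt_hyperbolicFlow z
  have hγ0 : γ 0 = z := by simp [γ]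
  let F : ℕ × ℕ → ℂ → ℂ := fun m s => c m * ((γ s).1 ^ m.1 * (γ s).2 ^ m.2)
  have hF : ∀ m s, HasDerivAt (F m)
      (((m.1 : ℂ) - m.2) * (c m * ((γ s).1 ^ m.1 * (γ s).2 ^ m.2))) s := by
    intro m s
    have hF' : F m = fun s => c m * (z.1 ^ m.1 * z.2 ^ m.2) *
        Complex.exp (((m.1 : ℂ) - m.2) * s) := by
      funext s
      have : Complex.exp (((m.1 : ℂ) - m.2) * s) =
          Complex.exp s ^ m.1 * Complex.exp (-s) ^ m.2 := by
        rw [← Complex.exp_nat_mul, ← Complex.exp_nat_mul, ← Complex.exp_add]; ring_nf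
      simp only [F, γ, this, mul_pow]; ring
    have h1 : HasDerivAt (fun s : ℂ => ((m.1 : ℂ) - m.2) * s) ((m.1 : ℂ) - m.2) s := by
      simpa using (hasDerivAt_id s).const_mul ((m.1 : ℂ) - m.2)
    have h2 := (h1.cexp).const_mul (c m * (z.1 ^ m.1 * z.2 ^ m.2))
    rw [← hF'] at h2
    refine h2.congr_deriv ?_
    have := congrFun hF' s
    simp only [F] at this
    rw [this]; ring
  have hbd : ∀ m, ∀ s ∈ Metric.ball (0 : ℂ) (1 / 2),
      ‖F m s‖ ≤ C * (1 / 2 : ℝ) ^ (m.1 + m.2) := by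
    intro m s hs
    have hs' : ‖s‖ ≤ 1 / 2 := by simpa using (mem_ball_zero_iff.1 hs).le
    refine h.term_le (z := γ s) ?_ m
    have hγs : ‖γ s‖ ≤ 2 * ‖z‖ := by
      refine norm_prod_le_iff.2 ⟨?_, ?_⟩ <;> rw [norm_mul]
      · gcongr
        exacts [norm_exp_le_two hs', norm_fst_le z]
      · gcongr
        exacts [norm_exp_le_two (by rwa [norm_neg]), norm_snd_le z]
    nlinarith
  have key := Complex.hasSum_deriv_of_summable_norm (summable_half_pow_add C)
    (fun m s _ => (hF m s).differentiableAt.differentiableWithinAt) Metric.isOpen_ball hbd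
    (Metric.mem_ball_self (by norm_num))
  have hd : HasFDerivAt (doubleSeries c) (fderiv ℂ (doubleSeries c) z) (γ 0) := by
    rw [hγ0]; exact han.differentiableAt.hasFDerivAt
  have hcomp := (hd.comp_hasDerivAt 0 hγ).deriv
  rw [← hcomp]
  refine Eq.trans key.tsum_eq.symm (tsum_congr fun m => ?_)
  rw [(hF m 0).deriv, hγ0, mul_assoc]

/-- Every analytic germ is the sum of a function of `x * y` and of a derivative along the
hyperbolic vector field `x ∂x - y ∂y`. -/
lemma AnalyticAt.exists_diagonal_add_fderiv {g : ℂ × ℂ → ℂ} (hg : AnalyticAt ℂ g 0) :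
    ∃ (D : ℂ → ℂ) (H : ℂ × ℂ → ℂ), AnalyticAt ℂ D 0 ∧ AnalyticAt ℂ H 0 ∧
      ∀ᶠ z in 𝓝 (0 : ℂ × ℂ), g z = D (z.1 * z.2) + fderiv ℂ H z (z.1, -z.2) := by
  obtain ⟨c, C, ρ, hc, hgc⟩ := hg.exists_doubleSeries
  have hdiag : GeomBound (fun m => if m.1 = m.2 then c m else 0) C ρ :=
    hc.mono fun m => by split_ifs <;> simp
  have hH : GeomBound (fun m => c m / ((m.1 : ℂ) - m.2)) C ρ := by
    refine hc.mono fun m => ?_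
    rw [norm_div]
    rcases eq_or_ne m.1 m.2 with h | h
    · simp [h]
    · refine div_le_self (norm_nonneg _) ?_
      have h1 : (1 : ℝ) ≤ |(((m.1 : ℤ) - m.2 : ℤ) : ℝ)| := by
        have : (1 : ℤ) ≤ |(m.1 : ℤ) - m.2| := Int.one_le_abs (by omega)
        exact_mod_cast this
      have h2 : ((m.1 : ℂ) - m.2) = (((m.1 : ℤ) - m.2 : ℤ) : ℂ) := by push_cast; ring
      rwa [h2, Complex.norm_intCast]
  have hoff : GeomBound (fun m => ((m.1 : ℂ) - m.2) * (c m / ((m.1 : ℂ) - m.2))) C ρ := by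
    refine hc.mono fun m => ?_
    rcases eq_or_ne ((m.1 : ℂ) - m.2) 0 with h | h
    · simp [h]
    · rw [mul_div_cancel₀ _ h]
  have hD : GeomBound (fun m => if m.2 = 0 then c (m.1, m.1) else 0) C (ρ ^ 2) := by
    obtain ⟨hC, hρ, hb⟩ := hc
    refine ⟨hC, by positivity, fun m => ?_⟩
    dsimp only
    split_ifs with h
    · refine (hb (m.1, m.1)).trans_eq ?_
      simp only [h]; ring
    · rw [norm_zero]; positivity
  have hDan : AnalyticAt ℂ (fun t : ℂ =>
      doubleSeries (fun m => if m.2 = 0 then c (m.1, m.1) else 0) (t, 0)) 0 :=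
    AnalyticAt.fun_comp (g := doubleSeries _) (f := fun t : ℂ => (t, (0 : ℂ))) hD.analyticAt
      (by fun_prop)
  refine ⟨_, _, hDan, hH.analyticAt, ?_⟩
  filter_upwards [hgc, hH.fderiv_hyperbolic,
    eventually_norm_mul_le ρ (by norm_num : (0 : ℝ) < 1 / 2)] with z hz hHz hzρ
  rw [hz, hHz]
  have h1 : doubleSeries c z = doubleSeries (fun m => (if m.1 = m.2 then c m else 0) +
      ((m.1 : ℂ) - m.2) * (c m / ((m.1 : ℂ) - m.2))) z := by
    congr 1
    funext m
    rcases eq_or_ne m.1 m.2 with h | h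
    · simp [h]
    · have : ((m.1 : ℂ) - m.2) ≠ 0 := sub_ne_zero.2 (by exact_mod_cast h)
      rw [if_neg h, mul_div_cancel₀ _ this, zero_add]
  rw [h1, hdiag.doubleSeries_add hoff hzρ]
  congr 1
  have i1 : Function.Injective fun i : ℕ => (i, i) := fun a b h => congrArg Prod.fst h
  have i2 : Function.Injective fun i : ℕ => (i, 0) := fun a b h => congrArg Prod.fst h
  rw [doubleSeries, doubleSeries, ← i1.tsum_eq, ← i2.tsum_eq]
  · refine tsum_congr fun i => ?_
    simp [mul_pow]
  · rintro ⟨i, j⟩ hm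
    rcases eq_or_ne j 0 with rfl | h
    · exact ⟨i, rfl⟩
    · simp [h] at hm
  · rintro ⟨i, j⟩ hm
    rcases eq_or_ne i j with rfl | h
    · exact ⟨i, rfl⟩
    · simp [h] at hm

/-- Hadamard's lemma for analytic germs in two variables. -/
lemma AnalyticAt.exists_hadamard {f : ℂ × ℂ → ℂ} (hf : AnalyticAt ℂ f 0) (hf0 : f 0 = 0) :
    ∃ A B : ℂ × ℂ → ℂ, AnalyticAt ℂ A 0 ∧ AnalyticAt ℂ B 0 ∧
      ∀ᶠ z in 𝓝 (0 : ℂ × ℂ), f z = z.1 * A z + z.2 * B z := by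
  obtain ⟨p, r, hp⟩ := hf
  have hq := p.shift.hasFPowerSeriesOnBall (by rw [p.radius_shift]; exact hp.r_pos.trans_le hp.r_le)
  have hu := hq.unshift (z := f 0)
  have hpu : p.shift.unshift (f 0) = p := by
    funext n
    cases n with
    | zero =>
      ext v
      simp [FormalMultilinearSeries.unshift, hp.coeff_zero]
    | succ n => exact ContinuousMultilinearMap.uncurry_curryRight _
  rw [hpu] at hu
  have hev : ∀ᶠ z in 𝓝 (0 : ℂ × ℂ), f z = p.shift.sum z z := by
    filter_upwards [Metric.eball_mem_nhds 0 hp.r_pos, Metric.eball_mem_nhds 0 hu.r_pos]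
      with z h1 h2
    have := (hp.hasSum h1).unique (hu.hasSum h2)
    simpa [hf0] using this
  have hS : AnalyticAt ℂ p.shift.sum 0 := hq.analyticAt
  refine ⟨fun z => p.shift.sum z (1, 0), fun z => p.shift.sum z (0, 1),
    (ContinuousLinearMap.apply ℂ ℂ ((1 : ℂ), (0 : ℂ))).comp_analyticAt hS,
    (ContinuousLinearMap.apply ℂ ℂ ((0 : ℂ), (1 : ℂ))).comp_analyticAt hS, ?_⟩
  filter_upwards [hev] with z hz
  have hzz : z = z.1 • ((1 : ℂ), (0 : ℂ)) + z.2 • ((0 : ℂ), (1 : ℂ)) := by ext <;> simp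
  rw [hz]
  conv_lhs => rw [hzz, map_add, map_smul, map_smul, ← hzz]
  simp

lemma ContinuousLinearMap.apply_eq_fst_snd {E : Type*} [NormedAddCommGroup E] [NormedSpace ℂ E]
    (L : ℂ × ℂ →L[ℂ] E) (z : ℂ × ℂ) : L z = z.1 • L (1, 0) + z.2 • L (0, 1) := by
  rw [← map_smul, ← map_smul, ← map_add]
  simp

lemma jacDet2_prodMk {u v : ℂ × ℂ → ℂ} {u' v' : ℂ × ℂ →L[ℂ] ℂ} {z : ℂ × ℂ}
    (hu : HasFDerivAt u u' z) (hv : HasFDerivAt v v' z) :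
    jacDet2 (fun w => (u w, v w)) z = u' (1, 0) * v' (0, 1) - u' (0, 1) * v' (1, 0) := by
  rw [jacDet2, (hu.prodMk hv).fderiv]
  simp

lemma jacDet2_comp {F G : ℂ × ℂ → ℂ × ℂ} {z : ℂ × ℂ} (hF : DifferentiableAt ℂ F (G z))
    (hG : DifferentiableAt ℂ G z) :
    jacDet2 (fun w => F (G w)) z = jacDet2 F (G z) * jacDet2 G z := by
  have h : fderiv ℂ (fun w => F (G w)) z = (fderiv ℂ F (G z)).comp (fderiv ℂ G z) :=
    fderiv_comp z hF hG
  simp only [jacDet2, h, ContinuousLinearMap.comp_apply]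
  rw [(fderiv ℂ F (G z)).apply_eq_fst_snd (fderiv ℂ G z (1, 0)),
    (fderiv ℂ F (G z)).apply_eq_fst_snd (fderiv ℂ G z (0, 1))]
  simp only [Prod.fst_add, Prod.snd_add, Prod.smul_fst, Prod.smul_snd, smul_eq_mul]
  ring

lemma analyticAt_jacDet2 {F : ℂ × ℂ → ℂ × ℂ} {z : ℂ × ℂ} (hF : AnalyticAt ℂ F z) :
    AnalyticAt ℂ (jacDet2 F) z := by
  have h : ∀ v, AnalyticAt ℂ (fun w => fderiv ℂ F w v) z := fun v =>
    (ContinuousLinearMap.apply ℂ (ℂ × ℂ) v).comp_analyticAt hF.fderiv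
  have h1 : ∀ v, AnalyticAt ℂ (fun w => (fderiv ℂ F w v).1) z := fun v =>
    (ContinuousLinearMap.fst ℂ ℂ ℂ).comp_analyticAt (h v)
  have h2 : ∀ v, AnalyticAt ℂ (fun w => (fderiv ℂ F w v).2) z := fun v =>
    (ContinuousLinearMap.snd ℂ ℂ ℂ).comp_analyticAt (h v)
  exact ((h1 _).mul (h2 _)).sub ((h1 _).mul (h2 _))

/-- The holomorphic inverse function theorem in two variables. -/
lemma AnalyticAt.exists_local_inverse {F : ℂ × ℂ → ℂ × ℂ} (hF : AnalyticAt ℂ F 0)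
    (hF0 : F 0 = 0) (hj : jacDet2 F 0 ≠ 0) :
    ∃ G : ℂ × ℂ → ℂ × ℂ, AnalyticAt ℂ G 0 ∧ G 0 = 0 ∧ (∀ᶠ z in 𝓝 (0 : ℂ × ℂ), F (G z) = z) ∧
      ∀ᶠ z in 𝓝 (0 : ℂ × ℂ), G (F z) = z := by
  have hinj : Function.Injective (fderiv ℂ F 0).toLinearMap := by
    rw [injective_iff_map_eq_zero]
    intro z hz
    replace hz : fderiv ℂ F 0 z = 0 := hz
    rw [ContinuousLinearMap.apply_eq_fst_snd] at hz
    have e1 := congrArg Prod.fst hz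
    have e2 := congrArg Prod.snd hz
    simp only [Prod.fst_add, Prod.snd_add, Prod.smul_fst, Prod.smul_snd, smul_eq_mul,
      Prod.fst_zero, Prod.snd_zero] at e1 e2
    unfold jacDet2 at hj
    ext
    · refine (mul_eq_zero.1 ?_).resolve_right hj
      linear_combination (fderiv ℂ F 0 (0, 1)).2 * e1 - (fderiv ℂ F 0 (0, 1)).1 * e2
    · refine (mul_eq_zero.1 ?_).resolve_right hj
      linear_combination (fderiv ℂ F 0 (1, 0)).1 * e2 - (fderiv ℂ F 0 (1, 0)).2 * e1
  let e : (ℂ × ℂ) ≃L[ℂ] (ℂ × ℂ) :=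
    (LinearEquiv.ofInjectiveEndo _ hinj).toContinuousLinearEquiv
  have he : (e : ℂ × ℂ →L[ℂ] ℂ × ℂ) = fderiv ℂ F 0 := by
    ext <;> rfl
  have hs : HasStrictFDerivAt F (e : ℂ × ℂ →L[ℂ] ℂ × ℂ) 0 := by
    rw [he]; exact hF.hasStrictFDerivAt
  refine ⟨hs.localInverse, ?_, ?_, ?_, hs.eventually_left_inverse⟩
  · have := (hs.toOpenPartialHomeomorph F).analyticAt_symm' (i := e)
      hs.mem_toOpenPartialHomeomorph_source hF he.symm
    rw [hs.toOpenPartialHomeomorph_coe, hF0] at this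
    exact this
  · simpa [hF0] using hs.localInverse_apply_image
  · simpa [hF0] using hs.eventually_right_inverse

lemma AnalyticAt.exists_sq_eq {E : Type*} [NormedAddCommGroup E] [NormedSpace ℂ E] {Δ : E → ℂ}
    {x : E} (hΔ : AnalyticAt ℂ Δ x) {σ : ℂ} (hσ : σ ^ 2 = Δ x) (h0 : Δ x ≠ 0) :
    ∃ s : E → ℂ, AnalyticAt ℂ s x ∧ s x = σ ∧ ∀ᶠ z in 𝓝 x, s z ^ 2 = Δ z := by
  have hq : AnalyticAt ℂ (fun z => Δ z / Δ x) x := hΔ.div analyticAt_const h0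
  refine ⟨fun z => σ * Complex.exp (Complex.log (Δ z / Δ x) / 2), ?_, ?_, ?_⟩
  · refine analyticAt_const.mul (AnalyticAt.cexp ((hq.clog ?_).div analyticAt_const two_ne_zero))
    simp [div_self h0]
  · simp [div_self h0]
  · filter_upwards [hΔ.continuousAt.eventually_ne h0] with z hz
    rw [mul_pow, ← Complex.exp_nat_mul, hσ, Nat.cast_two, mul_div_cancel₀ _ two_ne_zero,
      Complex.exp_log (div_ne_zero hz h0), mul_div_cancel₀ _ h0]

lemma hasFDerivAt_fst_mul_add_snd_mul {A B : ℂ × ℂ → ℂ} (hA : AnalyticAt ℂ A 0)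
    (hB : AnalyticAt ℂ B 0) :
    HasFDerivAt (fun z : ℂ × ℂ => z.1 * A z + z.2 * B z)
      (A 0 • ContinuousLinearMap.fst ℂ ℂ ℂ + B 0 • ContinuousLinearMap.snd ℂ ℂ ℂ) 0 := by
  have h := (hasFDerivAt_fst.mul hA.differentiableAt.hasFDerivAt).add
    (hasFDerivAt_snd.mul hB.differentiableAt.hasFDerivAt)
  exact h.congr_fderiv (by ext <;> simp)

lemma hessDet2_quadratic {f a b c : ℂ × ℂ → ℂ} (ha : AnalyticAt ℂ a 0) (hb : AnalyticAt ℂ b 0)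
    (hc : AnalyticAt ℂ c 0)
    (hf : ∀ᶠ z in 𝓝 (0 : ℂ × ℂ), f z = z.1 * (z.1 * a z + z.2 * b z) + z.2 * (z.2 * c z)) :
    hessDet2 f = 4 * a 0 * c 0 - b 0 ^ 2 := by
  have hd : ∀ {g : ℂ × ℂ → ℂ}, AnalyticAt ℂ g 0 → ∀ v, AnalyticAt ℂ (fun z => fderiv ℂ g z v) 0 :=
    fun hg v => (ContinuousLinearMap.apply ℂ ℂ v).comp_analyticAt hg.fderiv
  have hfd : ∀ᶠ z in 𝓝 (0 : ℂ × ℂ),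
      fderiv ℂ f z (1, 0) = z.1 * (2 * a z + z.1 * fderiv ℂ a z (1, 0) +
        z.2 * fderiv ℂ b z (1, 0)) + z.2 * (b z + z.2 * fderiv ℂ c z (1, 0)) ∧
      fderiv ℂ f z (0, 1) = z.1 * (b z + z.1 * fderiv ℂ a z (0, 1) +
        z.2 * fderiv ℂ b z (0, 1)) + z.2 * (2 * c z + z.2 * fderiv ℂ c z (0, 1)) := by
    filter_upwards [eventually_eventually_nhds.2 hf, ha.eventually_analyticAt,
      hb.eventually_analyticAt, hc.eventually_analyticAt] with z hz haz hbz hcz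
    have ha' := haz.differentiableAt.hasFDerivAt
    have hb' := hbz.differentiableAt.hasFDerivAt
    have hc' := hcz.differentiableAt.hasFDerivAt
    have h1 := (hasFDerivAt_fst (𝕜 := ℂ) (E := ℂ) (F := ℂ) (p := z))
    have h2 := (hasFDerivAt_snd (𝕜 := ℂ) (E := ℂ) (F := ℂ) (p := z))
    have h := ((h1.mul ((h1.mul ha').add (h2.mul hb'))).add
      (h2.mul (h2.mul hc'))).congr_of_eventuallyEq hz
    rw [h.fderiv]
    constructor <;> simp <;> ring
  have h1 := hasFDerivAt_fst_mul_add_snd_mul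
    (A := fun z => 2 * a z + z.1 * fderiv ℂ a z (1, 0) + z.2 * fderiv ℂ b z (1, 0))
    (B := fun z => b z + z.2 * fderiv ℂ c z (1, 0))
    (((analyticAt_const.mul ha).add (analyticAt_fst.mul (hd ha _))).add
      (analyticAt_snd.mul (hd hb _))) (hb.add (analyticAt_snd.mul (hd hc _)))
  have h2 := hasFDerivAt_fst_mul_add_snd_mul
    (A := fun z => b z + z.1 * fderiv ℂ a z (0, 1) + z.2 * fderiv ℂ b z (0, 1))
    (B := fun z => 2 * c z + z.2 * fderiv ℂ c z (0, 1))
    ((hb.add (analyticAt_fst.mul (hd ha _))).add (analyticAt_snd.mul (hd hb _)))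
    ((analyticAt_const.mul hc).add (analyticAt_snd.mul (hd hc _)))
  rw [hessDet2, (h1.congr_of_eventuallyEq (hfd.mono fun z h => h.1)).fderiv,
    (h2.congr_of_eventuallyEq (hfd.mono fun z h => h.2)).fderiv]
  simp
  ring

/-- A germ with a nondegenerate critical point is a product of two transverse germs. -/
lemma exists_eq_mul_of_hessDet2_ne_zero {f : ℂ × ℂ → ℂ} (hf : AnalyticAt ℂ f 0) (hf0 : f 0 = 0)
    (hgrad : fderiv ℂ f 0 = 0) (hhess : hessDet2 f ≠ 0) :
    ∃ M : ℂ × ℂ → ℂ × ℂ, AnalyticAt ℂ M 0 ∧ M 0 = 0 ∧ jacDet2 M 0 ≠ 0 ∧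
      ∀ᶠ z in 𝓝 (0 : ℂ × ℂ), f z = (M z).1 * (M z).2 := by
  obtain ⟨A, B, hA, hB, hAB⟩ := hf.exists_hadamard hf0
  have hfd := ((hasFDerivAt_fst_mul_add_snd_mul hA hB).congr_of_eventuallyEq hAB).fderiv
  rw [hgrad] at hfd
  have hA0 : A 0 = 0 := by simpa using (DFunLike.congr_fun hfd ((1 : ℂ), (0 : ℂ))).symm
  have hB0 : B 0 = 0 := by simpa using (DFunLike.congr_fun hfd ((0 : ℂ), (1 : ℂ))).symm
  obtain ⟨a, b₁, ha, hb₁, hab⟩ := hA.exists_hadamard hA0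
  obtain ⟨b₂, c, hb₂, hc, hbc⟩ := hB.exists_hadamard hB0
  obtain ⟨b, hb_def⟩ : ∃ b : ℂ × ℂ → ℂ, b = fun z => b₁ z + b₂ z := ⟨_, rfl⟩
  have hb : AnalyticAt ℂ b 0 := hb_def ▸ hb₁.add hb₂
  have hquad : ∀ᶠ z in 𝓝 (0 : ℂ × ℂ),
      f z = z.1 * (z.1 * a z + z.2 * b z) + z.2 * (z.2 * c z) := by
    filter_upwards [hAB, hab, hbc] with z h1 h2 h3
    rw [h1, h2, h3, hb_def]; ring
  rw [hessDet2_quadratic ha hb hc hquad] at hhess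
  have hΔ0 : b 0 ^ 2 - 4 * a 0 * c 0 ≠ 0 := fun h => hhess (by linear_combination -h)
  obtain ⟨σ, hσ, hbσ⟩ : ∃ σ : ℂ, σ ^ 2 = b 0 ^ 2 - 4 * a 0 * c 0 ∧ b 0 + σ ≠ 0 := by
    obtain ⟨τ, hτ⟩ := IsAlgClosed.exists_pow_nat_eq (b 0 ^ 2 - 4 * a 0 * c 0) two_pos
    by_cases h : b 0 + τ = 0
    · refine ⟨-τ, by rw [neg_sq, hτ], fun h' => hΔ0 ?_⟩
      have : τ = 0 := by linear_combination (h - h') / 2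
      rw [← hτ, this]; ring
    · exact ⟨τ, hτ, h⟩
  obtain ⟨s, hs, hs0, hsq⟩ := AnalyticAt.exists_sq_eq
    (Δ := fun z => b z ^ 2 - 4 * a z * c z) (x := 0)
    ((hb.pow 2).sub ((analyticAt_const.mul ha).mul hc)) hσ hΔ0
  have hbs : AnalyticAt ℂ (fun z => b z + s z) 0 := hb.add hs
  have hbs0 : b 0 + s 0 ≠ 0 := by rwa [hs0]
  have hr : AnalyticAt ℂ (fun z => 2 * c z / (b z + s z)) 0 :=
    (analyticAt_const.mul hc).div hbs hbs0
  have hl : AnalyticAt ℂ (fun z => (b z + s z) / 2) 0 := hbs.div analyticAt_const two_ne_zero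
  refine ⟨fun z => (z.1 * 1 + z.2 * (2 * c z / (b z + s z)), z.1 * a z + z.2 * ((b z + s z) / 2)),
    ((analyticAt_fst.mul analyticAt_const).add (analyticAt_snd.mul hr)).prod
      ((analyticAt_fst.mul ha).add (analyticAt_snd.mul hl)), by simp, ?_, ?_⟩
  · rw [jacDet2_prodMk (hasFDerivAt_fst_mul_add_snd_mul analyticAt_const hr)
      (hasFDerivAt_fst_mul_add_snd_mul ha hl)]
    have hσ0 : σ ≠ 0 := fun h => hΔ0 (by rw [← hσ, h]; ring)
    have : (b 0 + s 0) / 2 - 2 * c 0 / (b 0 + s 0) * a 0 = σ := by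
      rw [hs0]
      field_simp
      linear_combination -hσ
    simpa [this] using hσ0
  · filter_upwards [hquad, hsq, hbs.continuousAt.eventually_ne hbs0] with z h1 h2 h3
    rw [h1]
    field_simp
    linear_combination -(z.1 * z.2) * h2

lemma AnalyticAt.exists_primitive {D : ℂ → ℂ} (hD : AnalyticAt ℂ D 0) :
    ∃ κ k : ℂ → ℂ, AnalyticAt ℂ k 0 ∧ (∀ t, κ t = t * k t) ∧
      ∀ᶠ t in 𝓝 (0 : ℂ), HasDerivAt κ (D t) t := by
  obtain ⟨r, hr, hball⟩ := Metric.eventually_nhds_iff_ball.1 hD.eventually_analyticAt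
  have hdiff : DifferentiableOn ℂ D (Metric.ball 0 r) := fun t ht =>
    (hball t ht).differentiableAt.differentiableWithinAt
  obtain ⟨κ, hκ0, hκ⟩ := hdiff.isExactOn_ball.with_val_at 0 0
  have hκd : DifferentiableOn ℂ κ (Metric.ball 0 r) := fun t ht =>
    (hκ t ht).differentiableAt.differentiableWithinAt
  obtain ⟨p, hp⟩ := hκd.analyticAt (Metric.ball_mem_nhds 0 hr)
  refine ⟨κ, dslope κ 0, ⟨_, hp.has_fpower_series_dslope_fslope⟩, fun t => ?_, ?_⟩
  · have := sub_smul_dslope κ 0 t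
    rw [hκ0, sub_zero, sub_zero, smul_eq_mul] at this
    exact this.symm
  · filter_upwards [Metric.ball_mem_nhds 0 hr] with t ht using hκ t ht

lemma tendsto_fst_mul_snd : Tendsto (fun w : ℂ × ℂ => w.1 * w.2) (𝓝 0) (𝓝 0) := by
  have h : Continuous fun w : ℂ × ℂ => w.1 * w.2 := by fun_prop
  simpa using h.tendsto 0

lemma hasFDerivAt_comp_fst_mul_snd {k : ℂ → ℂ} {k' : ℂ} {w : ℂ × ℂ}
    (hk : HasDerivAt k k' (w.1 * w.2)) :
    HasFDerivAt (fun w : ℂ × ℂ => k (w.1 * w.2))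
      (k' • (w.1 • ContinuousLinearMap.snd ℂ ℂ ℂ + w.2 • ContinuousLinearMap.fst ℂ ℂ ℂ)) w :=
  hk.comp_hasFDerivAt w (hasFDerivAt_fst.mul hasFDerivAt_snd)

/-- The Jacobian of `(x, y) ↦ (x e ^ h, y e ^ (-h) k(xy))`. -/
lemma jacDet2_hyperbolicTwist {h : ℂ × ℂ → ℂ} {k : ℂ → ℂ} {k' : ℂ} {w : ℂ × ℂ}
    {h' : ℂ × ℂ →L[ℂ] ℂ} (hh : HasFDerivAt h h' w) (hk : HasDerivAt k k' (w.1 * w.2)) :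
    jacDet2 (fun w => (w.1 * Complex.exp (h w), w.2 * (Complex.exp (-h w) * k (w.1 * w.2)))) w =
      (k (w.1 * w.2) + w.1 * w.2 * k') * (1 + h' (w.1, -w.2)) := by
  have h1 := (hasFDerivAt_fst (𝕜 := ℂ) (E := ℂ) (F := ℂ) (p := w)).mul hh.cexp
  have h2 := (hasFDerivAt_snd (𝕜 := ℂ) (E := ℂ) (F := ℂ) (p := w)).mul
    (hh.neg.cexp.mul (hasFDerivAt_comp_fst_mul_snd hk))
  have hexp : Complex.exp (h w) * Complex.exp (-h w) = 1 := by
    rw [← Complex.exp_add, add_neg_cancel, Complex.exp_zero]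
  refine (jacDet2_prodMk h1 h2).trans ?_
  rw [h'.apply_eq_fst_snd (w.1, -w.2)]
  simp
  linear_combination ((k (w.1 * w.2) + w.1 * w.2 * k') *
    (1 + (w.1 * h' (1, 0) - w.2 * h' (0, 1)))) * hexp

/-- Every nonvanishing density is the Jacobian of a map preserving the foliation by the level
curves of `x * y`. -/
lemma AnalyticAt.exists_jacDet2_eq {g : ℂ × ℂ → ℂ} (hg : AnalyticAt ℂ g 0) (hg0 : g 0 ≠ 0) :
    ∃ (Θ : ℂ × ℂ → ℂ × ℂ) (κ : ℂ → ℂ), AnalyticAt ℂ Θ 0 ∧ Θ 0 = 0 ∧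
      AnalyticAt ℂ κ 0 ∧ κ 0 = 0 ∧ deriv κ 0 ≠ 0 ∧
      (∀ᶠ w in 𝓝 (0 : ℂ × ℂ), jacDet2 Θ w = g w) ∧ ∀ w, (Θ w).1 * (Θ w).2 = κ (w.1 * w.2) := by
  obtain ⟨D, H, hD, hH, hDH⟩ := hg.exists_diagonal_add_fderiv
  have hD0 : D 0 ≠ 0 := by
    have h := hDH.self_of_nhds
    have hz : ((0 : ℂ × ℂ).1, -(0 : ℂ × ℂ).2) = 0 := by simp
    rw [hz, map_zero] at h
    have h' : g 0 = D 0 := by simpa using h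
    rwa [← h']
  obtain ⟨κ, k, hk, hκk, hκ⟩ := hD.exists_primitive
  have hmul : AnalyticAt ℂ (fun w : ℂ × ℂ => w.1 * w.2) 0 := analyticAt_fst.mul analyticAt_snd
  have hkm : AnalyticAt ℂ (fun w : ℂ × ℂ => k (w.1 * w.2)) 0 :=
    AnalyticAt.fun_comp (g := k) (by simpa using hk) hmul
  have hE : AnalyticAt ℂ (fun t => (D t)⁻¹) 0 := hD.inv hD0
  have hEm : AnalyticAt ℂ (fun w : ℂ × ℂ => (D (w.1 * w.2))⁻¹) 0 :=
    AnalyticAt.fun_comp (g := fun t => (D t)⁻¹) (by simpa using hE) hmul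
  have hh : AnalyticAt ℂ (fun w : ℂ × ℂ => H w * (D (w.1 * w.2))⁻¹) 0 := hH.mul hEm
  have hκe : κ = fun t => t * k t := funext hκk
  refine ⟨fun w => (w.1 * Complex.exp (H w * (D (w.1 * w.2))⁻¹),
    w.2 * (Complex.exp (-(H w * (D (w.1 * w.2))⁻¹)) * k (w.1 * w.2))), κ,
    (analyticAt_fst.mul hh.cexp).prod (analyticAt_snd.mul (hh.neg.cexp.mul hkm)), by simp,
    hκe ▸ analyticAt_id.mul hk, by simp [hκk], ?_, ?_, ?_⟩
  · rwa [hκ.self_of_nhds.deriv]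
  · have ev := tendsto_fst_mul_snd.eventually (hκ.and (hk.eventually_analyticAt.and
      (hE.eventually_analyticAt.and (hD.continuousAt.eventually_ne hD0))))
    filter_upwards [ev, hDH, hH.eventually_analyticAt] with w hw hgw hHw
    obtain ⟨h1, h2, h3, h4⟩ := hw
    have hk' := h2.differentiableAt.hasDerivAt
    have hfd := hHw.differentiableAt.hasFDerivAt.mul
      (hasFDerivAt_comp_fst_mul_snd h3.differentiableAt.hasDerivAt)
    refine (jacDet2_hyperbolicTwist hfd hk').trans ?_
    have hder : D (w.1 * w.2) = k (w.1 * w.2) + w.1 * w.2 * deriv k (w.1 * w.2) := by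
      rw [hκe] at h1
      have := h1.unique ((hasDerivAt_id _).mul hk')
      simpa using this
    rw [← hder, hgw]
    simp
    field_simp
    ring
  · intro w
    rw [hκk]
    have hexp := Complex.exp_add (H w * (D (w.1 * w.2))⁻¹) (-(H w * (D (w.1 * w.2))⁻¹))
    rw [add_neg_cancel, Complex.exp_zero] at hexp
    linear_combination -(w.1 * w.2 * k (w.1 * w.2)) * hexp

/-- **Vey's isochore Morse lemma.**  If `f` is a holomorphic function germ at
`0 ∈ ℂ²` with `f(0) = 0`, vanishing gradient and nondegenerate Hessian at `0`, then
there are a symplectomorphism germ `φ` of `(ℂ²,0)` (i.e. a volume preserving local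
biholomorphism fixing `0`) and a biholomorphism germ `ψ` of `(ℂ,0)` with
`f ∘ φ = ψ(xy)` near the origin. -/
theorem vey_isochore_morse_lemma
    (f : ℂ × ℂ → ℂ) (hf : AnalyticAt ℂ f 0) (hf0 : f 0 = 0)
    (hgrad : fderiv ℂ f 0 = 0) (hhess : hessDet2 f ≠ 0) :
    ∃ φ : ℂ × ℂ → ℂ × ℂ, ∃ ψ : ℂ → ℂ,
      AnalyticAt ℂ φ 0 ∧ φ 0 = 0 ∧
      (∀ᶠ z in 𝓝 (0 : ℂ × ℂ), jacDet2 φ z = 1) ∧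
      AnalyticAt ℂ ψ 0 ∧ ψ 0 = 0 ∧ deriv ψ 0 ≠ 0 ∧
      ∀ᶠ z in 𝓝 (0 : ℂ × ℂ), f (φ z) = ψ (z.1 * z.2) := by
  obtain ⟨M, hM, hM0, hMj, hfM⟩ := exists_eq_mul_of_hessDet2_ne_zero hf hf0 hgrad hhess
  obtain ⟨N, hN, hN0, -, hNM⟩ := hM.exists_local_inverse hM0 hMj
  have hJN : AnalyticAt ℂ (fun w => jacDet2 M (N w)) 0 :=
    AnalyticAt.fun_comp (g := jacDet2 M) (by rw [hN0]; exact analyticAt_jacDet2 hM) hN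
  have hJN0 : jacDet2 M (N 0) ≠ 0 := by rwa [hN0]
  obtain ⟨Θ, κ, hΘ, hΘ0, hκ, hκ0, hκ', hΘj, hΘκ⟩ :=
    (hJN.inv hJN0).exists_jacDet2_eq (inv_ne_zero hJN0)
  have hS : AnalyticAt ℂ (fun z => Θ (M z)) 0 :=
    AnalyticAt.fun_comp (g := Θ) (by rwa [hM0]) hM
  have hMt : Tendsto M (𝓝 0) (𝓝 0) := by simpa [ContinuousAt, hM0] using hM.continuousAt
  have hSj : ∀ᶠ z in 𝓝 (0 : ℂ × ℂ), jacDet2 (fun z => Θ (M z)) z = 1 := by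
    filter_upwards [hMt.eventually hΘj, hMt.eventually hΘ.eventually_analyticAt,
      hM.eventually_analyticAt, hNM,
      (analyticAt_jacDet2 hM).continuousAt.eventually_ne hMj] with z h1 h2 h3 h4 h5
    rw [jacDet2_comp h2.differentiableAt h3.differentiableAt, h1]
    simp [h4, h5]
  obtain ⟨φ, hφ, hφ0, hSφ, -⟩ := hS.exists_local_inverse (by simp [hM0, hΘ0])
    (by rw [hSj.self_of_nhds]; exact one_ne_zero)
  have hφt : Tendsto φ (𝓝 0) (𝓝 0) := by simpa [ContinuousAt, hφ0] using hφ.continuousAt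
  have hψ := hκ.analyticAt_localInverse hκ'
  have hψd := hκ.hasStrictDerivAt.to_localInverse hκ'
  have hψl := hκ.hasStrictDerivAt.eventually_left_inverse hκ'
  rw [hκ0] at hψ hψd
  refine ⟨φ, hκ.hasStrictDerivAt.localInverse _ _ _ hκ', hφ, hφ0, ?_, hψ, ?_, ?_, ?_⟩
  · filter_upwards [hφt.eventually hSj, hφt.eventually hS.eventually_analyticAt,
      hφ.eventually_analyticAt, eventually_eventually_nhds.2 hSφ] with z h1 h2 h3 h4
    have h5 := jacDet2_comp h2.differentiableAt h3.differentiableAt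
    rw [h1, one_mul] at h5
    have h6 : fderiv ℂ (fun w => Θ (M (φ w))) z = ContinuousLinearMap.id ℂ (ℂ × ℂ) :=
      ((hasFDerivAt_id z).congr_of_eventuallyEq h4).fderiv
    rw [← h5, jacDet2, h6]
    simp
  · simpa [hκ0] using hψl.self_of_nhds
  · rw [hψd.hasDerivAt.deriv]
    exact inv_ne_zero hκ'
  · have hMφ : Tendsto (fun z => (M (φ z)).1 * (M (φ z)).2) (𝓝 0) (𝓝 0) :=
      tendsto_fst_mul_snd.comp (hMt.comp hφt)
    filter_upwards [hφt.eventually hfM, hSφ, hMφ.eventually hψl] with z h1 h2 h3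
    rw [h1, ← h3, ← hΘκ, h2]
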